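/- Let K be a compact Hausdorff space admitting a finitely supported Josefson–Nissenzweig sequence. Then there exists a finitely supported Josefson–Nissenzweig sequence ⟨θ_n⟩ on K which is disjointly supported, i.e. supp(θ_n) ∩ supp(θ_k) = ∅ for all n ≠ k. -/

import Mathlib

open MeasureTheory Filter Topology Set
open scoped ENNReal

namespace JNP

variable {K : Type*} [TopologicalSpace K] [MeasurableSpace K] [BorelSpace K]

/-- The total variation norm of a signed Borel measure. -/
noncomputable def tvNorm (μ : SignedMeasure K) : ℝ :=
  (μ.totalVariation Set.univ).toReal

/-- A signed Borel measure is Radon if its total variation is a regular measure. -/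
def IsRadon (μ : SignedMeasure K) : Prop :=
  μ.totalVariation.Regular

/-- The integral of a function against a signed measure. -/
noncomputable def integ (μ : SignedMeasure K) (f : K → ℝ) : ℝ :=
  ∫ x, f x ∂μ.toJordanDecomposition.posPart -
    ∫ x, f x ∂μ.toJordanDecomposition.negPart

/-- The support of a signed measure: the set of points all of whose open
neighbourhoods have nonzero total variation. -/
def msupport (μ : SignedMeasure K) : Set K :=
  {x : K | ∀ U : Set K, IsOpen U → x ∈ U → μ.totalVariation U ≠ 0}

/-- Weak* convergence of a sequence of signed measures: convergence of the integrals of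
every continuous real-valued function. -/
def WeakStarTendsto (μs : ℕ → SignedMeasure K) (μ : SignedMeasure K) : Prop :=
  ∀ f : C(K, ℝ), Tendsto (fun n => integ (μs n) f) atTop (𝓝 (integ μ f))

/-- A sequence of signed measures is weak* null if the integral of every continuous
real-valued function tends to `0`. -/
def WeakStarNull (μs : ℕ → SignedMeasure K) : Prop :=
  ∀ f : C(K, ℝ), Tendsto (fun n => integ (μs n) f) atTop (𝓝 (0 : ℝ))

/-- Weak convergence of a sequence of signed measures: convergence under every bounded
linear functional on the Banach space of signed measures with the total variation norm
(which, for Radon measures, is `C(K)*` by the Riesz representation theorem). -/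
def WeakTendsto (μs : ℕ → SignedMeasure K) (μ : SignedMeasure K) : Prop :=
  ∀ φ : SignedMeasure K →ₗ[ℝ] ℝ,
    (∃ C : ℝ, ∀ ν : SignedMeasure K, |φ ν| ≤ C * tvNorm ν) →
    Tendsto (fun n => φ (μs n)) atTop (𝓝 (φ μ))

variable (K) in
/-- The Grothendieck property: every weak* convergent sequence of signed Radon measures
is weakly convergent. -/
def GrothendieckProp : Prop :=
  ∀ (μs : ℕ → SignedMeasure K) (μ : SignedMeasure K),
    (∀ n, IsRadon (μs n)) → IsRadon μ → WeakStarTendsto μs μ → WeakTendsto μs μ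

variable (K) in
/-- The ℓ₁-Grothendieck property: every weak* convergent sequence of countably supported
signed Radon measures is weakly convergent. -/
def Ell1Grothendieck : Prop :=
  ∀ (μs : ℕ → SignedMeasure K) (μ : SignedMeasure K),
    (∀ n, IsRadon (μs n)) → (∀ n, (msupport (μs n)).Countable) →
    IsRadon μ → WeakStarTendsto μs μ → WeakTendsto μs μ

variable (K) in
/-- The Δ-Grothendieck property: every weak* convergent sequence of finitely supported
signed Radon measures is weakly convergent. -/
def DeltaGrothendieck : Prop :=
  ∀ (μs : ℕ → SignedMeasure K) (μ : SignedMeasure K),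
    (∀ n, IsRadon (μs n)) → (∀ n, (msupport (μs n)).Finite) →
    IsRadon μ → WeakStarTendsto μs μ → WeakTendsto μs μ

variable (K) in
/-- The finitely supported Josefson–Nissenzweig property: there is a weak* null sequence of
finitely supported signed Radon measures of total variation norm one. -/
def fsJNP : Prop :=
  ∃ μs : ℕ → SignedMeasure K,
    (∀ n, IsRadon (μs n)) ∧ (∀ n, (msupport (μs n)).Finite) ∧
    (∀ n, tvNorm (μs n) = 1) ∧ WeakStarNull μs

variable (K) in
/-- The countably supported Josefson–Nissenzweig property: there is a weak* null sequence of
countably supported signed Radon measures of total variation norm one. -/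
def csJNP : Prop :=
  ∃ μs : ℕ → SignedMeasure K,
    (∀ n, IsRadon (μs n)) ∧ (∀ n, (msupport (μs n)).Countable) ∧
    (∀ n, tvNorm (μs n) = 1) ∧ WeakStarNull μs

end JNP

namespace JNP

section Finsupp

variable {α : Type*}

/-- The ℓ₁-norm of a finitely supported function. -/
noncomputable def l1 (a : α →₀ ℝ) : ℝ := a.sum fun _ c => |c|

/-- The pairing of a finitely supported function with an arbitrary function. -/
noncomputable def pair (a : α →₀ ℝ) (f : α → ℝ) : ℝ := Finsupp.linearCombination ℝ f a

lemma l1_eq_sum {a : α →₀ ℝ} {S : Finset α} (h : a.support ⊆ S) : l1 a = ∑ x ∈ S, |a x| :=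
  Finsupp.sum_of_support_subset a h _ (by simp)

lemma pair_eq_sum (a : α →₀ ℝ) (f : α → ℝ) : pair a f = ∑ x ∈ a.support, a x * f x := rfl

lemma l1_nonneg (a : α →₀ ℝ) : 0 ≤ l1 a := Finset.sum_nonneg fun _ _ => abs_nonneg _

lemma l1_smul (c : ℝ) (a : α →₀ ℝ) : l1 (c • a) = |c| * l1 a := by
  rw [l1_eq_sum (Finsupp.support_smul (b := c) (g := a)), l1_eq_sum subset_rfl, Finset.mul_sum]
  simp [abs_mul]

lemma l1_filter_add (a : α →₀ ℝ) (p : α → Prop) [DecidablePred p] :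
    l1 (a.filter p) + l1 (a.filter fun x => ¬ p x) = l1 a := by
  rw [l1_eq_sum (a := a.filter p) (S := a.support) (by simp),
    l1_eq_sum (a := a.filter fun x => ¬ p x) (S := a.support) (by simp),
    l1_eq_sum (a := a) subset_rfl, ← Finset.sum_add_distrib]
  refine Finset.sum_congr rfl fun x _ => ?_
  by_cases h : p x <;> simp [h]

lemma abs_pair_le (a : α →₀ ℝ) {f : α → ℝ} {C : ℝ} (hf : ∀ x, |f x| ≤ C) :
    |pair a f| ≤ C * l1 a := by
  rw [pair_eq_sum, l1_eq_sum subset_rfl, Finset.mul_sum]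
  refine (Finset.abs_sum_le_sum_abs _ _).trans (Finset.sum_le_sum fun x _ => ?_)
  rw [abs_mul, mul_comm]
  exact mul_le_mul_of_nonneg_right (hf x) (abs_nonneg _)

lemma l1_filter_mem_le [DecidableEq α] (a : α →₀ ℝ) (F : Finset α) {δ : ℝ}
    (h : ∀ x ∈ F, |a x| ≤ δ) : l1 (a.filter (· ∈ F)) ≤ F.card * δ := by
  rw [l1_eq_sum (S := F) (by intro x hx; simp at hx; exact hx.2), ← nsmul_eq_mul]
  exact Finset.sum_le_card_nsmul _ _ _ fun x hx => by simpa [hx] using h x hx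

/-- Subtracting `b` does not decrease the `ℓ₁`-norm of `a` off the support of `b`. -/
lemma l1_filter_notMem_support_le [DecidableEq α] (a b : α →₀ ℝ) :
    l1 (a.filter (· ∉ b.support)) ≤ l1 (a - b) := by
  rw [← l1_filter_add (a - b) (· ∉ b.support)]
  have : (a - b).filter (· ∉ b.support) = a.filter (· ∉ b.support) := by
    ext x
    by_cases h : x ∈ b.support
    · simp only [Finsupp.filter_apply, h, not_true, if_false]
    · simp only [Finsupp.filter_apply, h, not_false_eq_true, if_true, Finsupp.sub_apply,
        Finsupp.notMem_support_iff.1 h, sub_zero]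
  rw [this]
  linarith [l1_nonneg ((a - b).filter fun x => ¬ x ∉ b.support)]

lemma abs_apply_le_l1 (a : α →₀ ℝ) (x : α) : |a x| ≤ l1 a := by
  by_cases hx : x ∈ a.support
  · exact Finset.single_le_sum (f := fun x => |a x|) (fun _ _ => abs_nonneg _) hx
  · rw [Finsupp.notMem_support_iff.1 hx, abs_zero]
    exact l1_nonneg a

/-- Pigeonhole: a bounded sequence in `ℓ₁` has two terms, arbitrarily far out, which are close
to each other on a given finite set. -/
lemma exists_lt_forall_abs_sub_le {b : ℕ → α →₀ ℝ} (h1 : ∀ n, l1 (b n) ≤ 1) (F : Finset α)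
    {δ : ℝ} (hδ : 0 < δ) (N : ℕ) :
    ∃ i j, N ≤ i ∧ i < j ∧ ∀ x ∈ F, |(b j - b i) x| ≤ δ := by
  let u : ℕ → F → ℝ := fun n x => b n x
  obtain ⟨l, -, φ, hφ, hl⟩ := tendsto_subseq_of_bounded
    (Metric.isBounded_closedBall (x := (0 : F → ℝ)) (r := 1)) (x := u) (fun n => by
      rw [mem_closedBall_zero_iff, pi_norm_le_iff_of_nonneg zero_le_one]
      exact fun x => (abs_apply_le_l1 _ _).trans (h1 n))
  obtain ⟨M, hM⟩ := Metric.cauchySeq_iff.1 hl.cauchySeq δ hδ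
  refine ⟨φ (max M N), φ (max M N + 1), (le_max_right _ _).trans (hφ.le_apply),
    hφ (Nat.lt_succ_self _), fun x hx => ?_⟩
  have h := hM (max M N + 1) ((le_max_left _ _).trans (Nat.le_succ _)) _ (le_max_left M N)
  have h2 := (dist_le_pi_dist _ _ (⟨x, hx⟩ : F)).trans h.le
  simpa [u, Real.dist_eq] using h2

end Finsupp

section NullSequences

variable {K : Type*} [TopologicalSpace K]

/-- A pointwise null sequence of norm one functionals does not concentrate on a finite set. -/
lemma frequently_l1_filter_notMem [CompactSpace K] [T2Space K] [DecidableEq K] {b : ℕ → K →₀ ℝ}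
    (h1 : ∀ n, l1 (b n) = 1)
    (h0 : ∀ f : C(K, ℝ), Tendsto (fun n => pair (b n) f) atTop (𝓝 0)) (F : Finset K) :
    ∃ᶠ n in atTop, 1 / 4 < l1 ((b n).filter (· ∉ F)) := by
  intro hcon
  have hsign : ∀ s : Finset K, ∃ f : C(K, ℝ), (∀ x ∈ s, f x = 1) ∧
      (∀ x ∈ F \ s, f x = -1) ∧ ∀ x, |f x| ≤ 1 := by
    intro s
    obtain ⟨g, hg0, hg1, hg⟩ := exists_continuous_zero_one_of_isClosed
      s.finite_toSet.isClosed (F \ s).finite_toSet.isClosed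
      (by exact_mod_cast Finset.disjoint_sdiff)
    have hval (x : K) : (1 - 2 * g : C(K, ℝ)) x = 1 - 2 * g x := rfl
    refine ⟨1 - 2 * g, fun x hx => ?_, fun x hx => ?_, fun x => ?_⟩
    · have hx0 : g x = 0 := hg0 hx
      rw [hval, hx0]; norm_num
    · have hx1 : g x = 1 := hg1 hx
      rw [hval, hx1]; norm_num
    · obtain ⟨h, h'⟩ := hg x
      rw [hval, abs_le]
      constructor <;> linarith
  choose f hf1 hf2 hf3 using hsign
  have hsmall : ∀ᶠ n in atTop, ∀ s ∈ F.powerset, |pair (b n) (f s)| < 1 / 2 := by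
    rw [eventually_all_finset]
    intro s _
    have := (h0 (f s)).abs
    rw [abs_zero] at this
    exact this.eventually_lt_const (by norm_num)
  obtain ⟨n, hn, hn'⟩ := (hsmall.and hcon).exists
  set s : Finset K := {x ∈ F | 0 ≤ b n x} with hs
  have hpair := hn s (by simp [hs])
  have hsplit : pair (b n) (f s) =
      pair ((b n).filter (· ∈ F)) (f s) + pair ((b n).filter (· ∉ F)) (f s) := by
    rw [pair, pair, pair, ← map_add, Finsupp.filter_add_filter_not]
  have hF : pair ((b n).filter (· ∈ F)) (f s) = l1 ((b n).filter (· ∈ F)) := by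
    rw [pair_eq_sum, l1_eq_sum subset_rfl]
    refine Finset.sum_congr rfl fun x hx => ?_
    have hxF : x ∈ F := by simp at hx; exact hx.2
    rw [Finsupp.filter_apply_pos (· ∈ F) _ hxF]
    by_cases hx0 : 0 ≤ b n x
    · rw [hf1 s x (by simp [hs, hxF, hx0]), abs_of_nonneg hx0, mul_one]
    · rw [hf2 s x (by simp [hs, hxF, hx0]), abs_of_neg (not_le.1 hx0), mul_neg_one]
  have hoff := abs_pair_le ((b n).filter (· ∉ F)) (hf3 s)
  have htot := l1_filter_add (b n) (· ∈ F)
  rw [h1 n] at htot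
  rw [abs_lt] at hpair
  rw [abs_le] at hoff
  linarith [hpair.2, hoff.1]

/-- One step of the gliding hump construction. -/
lemma exists_disjoint_support [CompactSpace K] [DecidableEq K] {b : ℕ → K →₀ ℝ}
    (h1 : ∀ n, l1 (b n) ≤ 1)
    (hb : ∀ i j, i < j → 1 / 4 < l1 ((b j).filter (· ∉ (b i).support)))
    (F : Finset K) (k : ℕ) :
    ∃ d : K →₀ ℝ, l1 d = 1 ∧ Disjoint F d.support ∧ ∃ i j, k ≤ i ∧ k ≤ j ∧ ∀ f : C(K, ℝ),
      |pair d f| ≤ 8 * (|pair (b i) f| + |pair (b j) f| + ‖f‖ * (1 / (k + 1))) := by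
  set δ : ℝ := 1 / (8 * (k + 1) * (F.card + 1)) with hδ
  obtain ⟨i, j, hki, hij, hF⟩ := exists_lt_forall_abs_sub_le h1 F (δ := δ) (by positivity) k
  set e := b j - b i with he
  have hin : l1 (e.filter (· ∈ F)) ≤ 1 / (8 * (k + 1)) := by
    refine (l1_filter_mem_le e F hF).trans ?_
    rw [hδ, mul_one_div, div_le_div_iff₀ (by positivity) (by positivity)]
    have : (0 : ℝ) ≤ 8 * (k + 1) := by positivity
    nlinarith
  have hk : (1 : ℝ) / (k + 1) ≤ 1 := by
    rw [div_le_one (by positivity)]; linarith [k.cast_nonneg (α := ℝ)]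
  have hk' : (1 : ℝ) / (8 * (k + 1)) = 1 / (k + 1) / 8 := by field_simp
  have hk0 : (0 : ℝ) ≤ 1 / (k + 1) := by positivity
  have hbig : 1 / 8 ≤ l1 (e.filter (· ∉ F)) := by
    have := l1_filter_add e (· ∈ F)
    have := (hb i j hij).trans_le (l1_filter_notMem_support_le (b j) (b i))
    linarith
  set c := e.filter (· ∉ F) with hc
  have hcpos : 0 < l1 c := by linarith
  refine ⟨(l1 c)⁻¹ • c, ?_, ?_, i, j, hki, hki.trans hij.le, fun f => ?_⟩
  · rw [l1_smul, abs_of_pos (inv_pos.2 hcpos), inv_mul_cancel₀ hcpos.ne']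
  · rw [Finset.disjoint_right]
    intro x hx
    have := Finsupp.support_smul hx
    simp [hc] at this
    exact this.2
  · have hsplit : pair c f = pair (b j) f - pair (b i) f - pair (e.filter (· ∈ F)) f := by
      have : pair e f = pair (e.filter (· ∈ F)) f + pair c f := by
        rw [pair, pair, pair, ← map_add, hc, Finsupp.filter_add_filter_not]
      have h2 : pair e f = pair (b j) f - pair (b i) f := by
        rw [pair, pair, pair, he, map_sub]
      linarith
    have h3 := abs_pair_le (e.filter (· ∈ F)) (fun x => f.norm_coe_le_norm x)
    have h4 : |pair c f| ≤ |pair (b i) f| + |pair (b j) f| + ‖f‖ * (1 / (k + 1)) := by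
      have h5 : ‖f‖ * l1 (e.filter (· ∈ F)) ≤ ‖f‖ * (1 / (k + 1)) :=
        mul_le_mul_of_nonneg_left (by linarith) (norm_nonneg f)
      rw [hsplit]
      have := abs_sub (pair (b j) f - pair (b i) f) (pair (e.filter (· ∈ F)) f)
      have := abs_sub (pair (b j) f) (pair (b i) f)
      linarith
    have h6 : pair ((l1 c)⁻¹ • c) f = (l1 c)⁻¹ * pair c f := by
      rw [pair, pair, map_smul, smul_eq_mul]
    rw [h6, abs_mul, abs_of_pos (inv_pos.2 hcpos)]
    refine mul_le_mul ?_ h4 (abs_nonneg _) (by norm_num)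
    rw [inv_le_comm₀ hcpos (by norm_num)]
    linarith

/-- From a pointwise null sequence of norm one finitely supported functionals one obtains
a disjointly supported one. -/
theorem exists_pairwise_disjoint_support [CompactSpace K] [T2Space K] {b : ℕ → K →₀ ℝ}
    (h1 : ∀ n, l1 (b n) = 1)
    (h0 : ∀ f : C(K, ℝ), Tendsto (fun n => pair (b n) f) atTop (𝓝 0)) :
    ∃ d : ℕ → K →₀ ℝ, (∀ n, l1 (d n) = 1) ∧
      (∀ f : C(K, ℝ), Tendsto (fun n => pair (d n) f) atTop (𝓝 0)) ∧
      ∀ m n, m ≠ n → Disjoint (d m).support (d n).support := by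
  classical
  obtain ⟨φ, -, hφ⟩ := exists_seq_of_forall_finset_exists (fun _ : ℕ => True)
    (fun i j => i < j ∧ 1 / 4 < l1 ((b j).filter (· ∉ (b i).support))) (fun s _ => by
      obtain ⟨n, hn, hn'⟩ := ((frequently_l1_filter_notMem h1 h0
        (s.biUnion fun i => (b i).support)).and_eventually
          (eventually_gt_atTop (s.sup id))).exists
      refine ⟨n, trivial, fun i hi => ⟨(Finset.le_sup (f := id) hi).trans_lt hn', ?_⟩⟩
      refine hn.trans_le ?_
      rw [l1_eq_sum (S := (b n).support) (by simp), l1_eq_sum (S := (b n).support) (by simp)]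
      refine Finset.sum_le_sum fun x _ => ?_
      by_cases hx : x ∈ (b i).support
      · have : x ∈ s.biUnion fun i => (b i).support := Finset.mem_biUnion.2 ⟨i, hi, hx⟩
        rw [Finsupp.filter_apply_neg (· ∉ s.biUnion fun i => (b i).support) _
          (not_not.2 this), abs_zero]
        exact abs_nonneg _
      · rw [Finsupp.filter_apply_pos (· ∉ (b i).support) _ hx, Finsupp.filter_apply]
        split_ifs <;> simp)
  have hmono : StrictMono φ := fun i j h => (hφ i j h).1
  set c : ℕ → K →₀ ℝ := fun n => b (φ n)
  have hc0 : ∀ f : C(K, ℝ), Tendsto (fun n => pair (c n) f) atTop (𝓝 0) :=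
    fun f => (h0 f).comp hmono.tendsto_atTop
  obtain ⟨p, hp, hpr⟩ := exists_seq_of_forall_finset_exists
    (fun p : ℕ × (K →₀ ℝ) => l1 p.2 = 1 ∧ ∃ i j, p.1 ≤ i ∧ p.1 ≤ j ∧ ∀ f : C(K, ℝ),
      |pair p.2 f| ≤ 8 * (|pair (c i) f| + |pair (c j) f| + ‖f‖ * (1 / (p.1 + 1))))
    (fun p q => p.1 < q.1 ∧ Disjoint p.2.support q.2.support) (fun s _ => by
      obtain ⟨d, hd1, hdF, hd⟩ := exists_disjoint_support (b := c) (fun n => (h1 _).le)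
        (fun i j h => (hφ i j h).2) (s.biUnion fun p => p.2.support) (s.sup Prod.fst + 1)
      refine ⟨⟨s.sup Prod.fst + 1, d⟩, ⟨hd1, hd⟩, fun q hq => ⟨?_, ?_⟩⟩
      · exact Nat.lt_succ_of_le (Finset.le_sup (f := Prod.fst) hq)
      · exact (Finset.disjoint_biUnion_left _ _ _).1 hdF q hq)
  have hpmono : StrictMono fun n => (p n).1 := fun i j h => (hpr i j h).1
  choose hp1 i j hi hj hf using hp
  refine ⟨fun n => (p n).2, hp1, fun f => ?_, fun m n hmn => ?_⟩
  · have hi' : Tendsto i atTop atTop := tendsto_atTop_mono hi hpmono.tendsto_atTop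
    have hj' : Tendsto j atTop atTop := tendsto_atTop_mono hj hpmono.tendsto_atTop
    have hk : Tendsto (fun n => 1 / (((p n).1 : ℝ) + 1)) atTop (𝓝 0) :=
      tendsto_one_div_add_atTop_nhds_zero_nat.comp hpmono.tendsto_atTop
    have hlim := ((((hc0 f).comp hi').abs.add ((hc0 f).comp hj').abs).add
      (hk.const_mul ‖f‖)).const_mul 8
    simp only [abs_zero, add_zero, mul_zero] at hlim
    exact squeeze_zero_norm (fun n => hf n f) hlim
  · rcases hmn.lt_or_gt with h | h
    · exact (hpr m n h).2
    · exact (hpr n m h).2.symm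

end NullSequences

section Measures

variable {X : Type*} [MeasurableSpace X]

lemma integral_eq_sum_of_compl_null [MeasurableSingletonClass X] (ν : Measure X)
    [IsFiniteMeasure ν] (S : Finset X) (hS : ν (↑S)ᶜ = 0) (f : X → ℝ) : ∫ x, f x ∂ν = ∑ x ∈ S, ν.real {x} * f x := by
  have h : ν.restrict ↑S = ν := Measure.restrict_eq_self_of_ae_mem (by
    rw [ae_iff]; exact hS)
  have h2 := setIntegral_finset (μ := ν) S (f := f) (by
    exact IntegrableOn.finset)
  rw [h] at h2
  simpa using h2

/-- The finitely supported measure on `S` with masses given by the positive part of `w`. -/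
noncomputable def atomic (S : Finset X) (w : X → ℝ) : Measure X :=
  ∑ y ∈ S, ENNReal.ofReal (w y) • Measure.dirac y

lemma atomic_apply (S : Finset X) (w : X → ℝ) {A : Set X} (hA : MeasurableSet A) :
    atomic S w A = ∑ y ∈ S, ENNReal.ofReal (w y) * A.indicator 1 y := by
  simp [atomic, Measure.finsetSum_apply, hA]

instance (S : Finset X) (w : X → ℝ) : IsFiniteMeasure (atomic S w) := by
  constructor
  rw [atomic_apply S w MeasurableSet.univ]
  simp

lemma atomic_singleton [MeasurableSingletonClass X] {S : Finset X} {w : X → ℝ} {x : X}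
    (hx : x ∈ S) :
    atomic S w {x} = ENNReal.ofReal (w x) := by
  classical
  rw [atomic_apply S w (measurableSet_singleton x), Finset.sum_eq_single x] <;>
    simp +contextual [hx]

lemma atomic_compl [MeasurableSingletonClass X] (S : Finset X) (w : X → ℝ) :
    atomic S w (↑S)ᶜ = 0 := by
  rw [atomic_apply S w S.measurableSet.compl]
  refine Finset.sum_eq_zero fun y hy => ?_
  simp [hy]

lemma totalVariation_lt_top (μ : SignedMeasure X) (A : Set X) : μ.totalVariation A < ⊤ := by
  have := μ.toJordanDecomposition.posPart_finite
  have := μ.toJordanDecomposition.negPart_finite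
  exact (ENNReal.add_lt_top.2 ⟨measure_lt_top _ _, measure_lt_top _ _⟩)

lemma posPart_le (μ : SignedMeasure X) (A : Set X) :
    μ.toJordanDecomposition.posPart A ≤ μ.totalVariation A := by
  simp [SignedMeasure.totalVariation]

lemma negPart_le (μ : SignedMeasure X) (A : Set X) :
    μ.toJordanDecomposition.negPart A ≤ μ.totalVariation A := by
  simp [SignedMeasure.totalVariation]

end Measures

variable {K : Type*} [TopologicalSpace K] [MeasurableSpace K]

lemma regular_of_finset [T2Space K] (ν : Measure K) [IsFiniteMeasure ν] (S : Finset K)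
    (hS : ν (↑S)ᶜ = 0) : ν.Regular := by
  have key (A B : Set K) (h : ∀ x ∈ S, x ∈ A → x ∈ B) : ν A ≤ ν B := by
    have : A ⊆ B ∪ (↑S)ᶜ := by
      intro x hx
      by_cases hxS : x ∈ S
      · exact Or.inl (h x hxS hx)
      · exact Or.inr (by simpa using hxS)
    calc ν A ≤ ν (B ∪ (↑S)ᶜ) := measure_mono this
      _ ≤ ν B + ν (↑S)ᶜ := measure_union_le _ _
      _ = ν B := by rw [hS, add_zero]
  have : ν.OuterRegular := by
    refine ⟨fun A _ r hr => ⟨(↑S \ A)ᶜ, ?_, ?_, lt_of_le_of_lt (key _ _ ?_) hr⟩⟩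
    · intro x hx; simp [hx]
    · exact (S.finite_toSet.sdiff).isClosed.isOpen_compl
    · intro x hxS hx; simpa [hxS] using hx
  refine ⟨fun U _ r hr => ⟨↑S ∩ U, inter_subset_right, ?_, lt_of_lt_of_le hr (key _ _ ?_)⟩⟩
  · exact (S.finite_toSet.inter_of_left U).isCompact
  · intro x hxS hx; exact ⟨hxS, hx⟩

lemma totalVariation_compl_msupport [T2Space K] {μ : SignedMeasure K} (hR : IsRadon μ)
    (hfin : (msupport μ).Finite) : μ.totalVariation (msupport μ)ᶜ = 0 := by
  have := hR
  unfold IsRadon at this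
  rw [hfin.isClosed.isOpen_compl.measure_eq_iSup_isCompact]
  simp only [ENNReal.iSup_eq_zero]
  intro C hC hCc
  refine hCc.measure_zero_of_nhdsWithin fun x hx => ?_
  have hx' := hC hx
  simp only [msupport, mem_compl_iff, mem_ofPred_eq, not_forall, not_not] at hx'
  obtain ⟨U, hU, hxU, h0⟩ := hx'
  exact ⟨U, mem_nhdsWithin_of_mem_nhds (hU.mem_nhds hxU), h0⟩

variable [BorelSpace K]

/-- The mass of a signed measure at a point. -/
noncomputable def mass (μ : SignedMeasure K) (x : K) : ℝ :=
  μ.toJordanDecomposition.posPart.real {x} - μ.toJordanDecomposition.negPart.real {x}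

lemma integ_eq_sum [T2Space K] (μ : SignedMeasure K) (S : Finset K)
    (hS : μ.totalVariation (↑S)ᶜ = 0) (f : K → ℝ) :
    integ μ f = ∑ x ∈ S, mass μ x * f x := by
  have := μ.toJordanDecomposition.posPart_finite
  have := μ.toJordanDecomposition.negPart_finite
  rw [integ, integral_eq_sum_of_compl_null _ S (le_antisymm (hS ▸ posPart_le μ _) zero_le),
    integral_eq_sum_of_compl_null _ S (le_antisymm (hS ▸ negPart_le μ _) zero_le),
    ← Finset.sum_sub_distrib]
  simp only [mass, sub_mul]

lemma tvNorm_eq_sum [T2Space K] (μ : SignedMeasure K) (S : Finset K)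
    (hS : μ.totalVariation (↑S)ᶜ = 0) : tvNorm μ = ∑ x ∈ S, |mass μ x| := by
  have := μ.toJordanDecomposition.posPart_finite
  have := μ.toJordanDecomposition.negPart_finite
  have : IsFiniteMeasure μ.totalVariation := ⟨totalVariation_lt_top μ _⟩
  have h := integral_eq_sum_of_compl_null μ.totalVariation S hS (fun _ => 1)
  simp only [integral_const, smul_eq_mul, mul_one] at h
  refine Eq.trans h (Finset.sum_congr rfl fun x _ => ?_)
  have hadd : μ.totalVariation.real {x} =
      μ.toJordanDecomposition.posPart.real {x} + μ.toJordanDecomposition.negPart.real {x} := by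
    simp [SignedMeasure.totalVariation, measureReal_add_apply]
  rw [hadd, mass]
  obtain ⟨A, -, hA, hA'⟩ := μ.toJordanDecomposition.mutuallySingular
  by_cases hx : x ∈ A
  · have : μ.toJordanDecomposition.posPart.real {x} = 0 := by
      rw [measureReal_def, measure_mono_null (singleton_subset_iff.2 hx) hA]; rfl
    rw [this]; simp [abs_of_nonneg]
  · have : μ.toJordanDecomposition.negPart.real {x} = 0 := by
      rw [measureReal_def, measure_mono_null (singleton_subset_iff.2 hx) hA']; rfl
    rw [this]; simp [abs_of_nonneg]

lemma exists_finsupp [T2Space K] {μ : SignedMeasure K} (hR : IsRadon μ)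
    (hfin : (msupport μ).Finite) :
    ∃ a : K →₀ ℝ, l1 a = tvNorm μ ∧ ∀ f : K → ℝ, pair a f = integ μ f := by
  classical
  have hS : μ.totalVariation (↑hfin.toFinset)ᶜ = 0 := by
    simpa using totalVariation_compl_msupport hR hfin
  refine ⟨Finsupp.onFinset hfin.toFinset
    (fun x => if x ∈ hfin.toFinset then mass μ x else 0) (by
      intro x hx; by_contra h; simp [h] at hx), ?_, fun f => ?_⟩
  · rw [tvNorm_eq_sum μ _ hS, l1, Finsupp.onFinset_sum _ (by simp)]
    exact Finset.sum_congr rfl fun x hx => by rw [if_pos hx]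
  · rw [integ_eq_sum μ _ hS, pair, Finsupp.linearCombination_apply,
      Finsupp.onFinset_sum _ (by simp)]
    exact Finset.sum_congr rfl fun x hx => by rw [if_pos hx, smul_eq_mul]

lemma exists_signedMeasure [T2Space K] (a : K →₀ ℝ) :
    ∃ μ : SignedMeasure K, IsRadon μ ∧ msupport μ ⊆ ↑a.support ∧ tvNorm μ = l1 a ∧
      ∀ f : K → ℝ, integ μ f = pair a f := by
  classical
  let J : JordanDecomposition K :=
    { posPart := atomic a.support a
      negPart := atomic a.support (fun x => - a x)
      posPart_finite := inferInstance
      negPart_finite := inferInstance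
      mutuallySingular := by
        have hm : MeasurableSet (↑({x ∈ a.support | a x < 0}) : Set K) :=
          Finset.measurableSet _
        refine ⟨_, hm, ?_, ?_⟩
        · rw [atomic_apply _ _ hm]
          refine Finset.sum_eq_zero fun y _ => ?_
          by_cases hy : a y < 0
          · simp [ENNReal.ofReal_of_nonpos hy.le]
          · simp [hy]
        · rw [atomic_apply _ _ hm.compl]
          refine Finset.sum_eq_zero fun y hy => ?_
          by_cases hy' : a y < 0
          · have := Finsupp.mem_support_iff.1 hy
            simp [hy', this]
          · simp [ENNReal.ofReal_of_nonpos (neg_nonpos.2 (not_lt.1 hy'))] }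
  have hJ : J.toSignedMeasure.toJordanDecomposition = J :=
    J.toJordanDecomposition_toSignedMeasure
  have hS : J.toSignedMeasure.totalVariation (↑a.support)ᶜ = 0 := by
    rw [SignedMeasure.totalVariation, hJ, Measure.add_apply, atomic_compl, atomic_compl, add_zero]
  have hmass : ∀ x ∈ a.support, mass J.toSignedMeasure x = a x := by
    intro x hx
    rw [mass, hJ, measureReal_def, measureReal_def, atomic_singleton hx, atomic_singleton hx,
      ENNReal.toReal_ofReal', ENNReal.toReal_ofReal']
    exact max_zero_sub_max_neg_zero_eq_self _
  have : IsFiniteMeasure J.toSignedMeasure.totalVariation := ⟨totalVariation_lt_top _ _⟩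
  refine ⟨J.toSignedMeasure, regular_of_finset _ a.support hS, ?_, ?_, fun f => ?_⟩
  · intro x hx
    by_contra hxS
    exact hx _ a.support.finite_toSet.isClosed.isOpen_compl hxS hS
  · rw [tvNorm_eq_sum _ _ hS, l1, Finsupp.sum]
    exact Finset.sum_congr rfl fun x hx => by rw [hmass x hx]
  · rw [integ_eq_sum _ _ hS, pair, Finsupp.linearCombination_apply, Finsupp.sum]
    exact Finset.sum_congr rfl fun x hx => by rw [hmass x hx, smul_eq_mul]


end JNP

/-- If a compact Hausdorff space admits a finitely supported Josefson–Nissenzweig sequence,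
then it admits a disjointly supported one. -/
theorem stmt_4 (K : Type*) [TopologicalSpace K] [MeasurableSpace K] [BorelSpace K]
    [CompactSpace K] [T2Space K] (h : JNP.fsJNP K) :
    ∃ θ : ℕ → MeasureTheory.SignedMeasure K,
      (∀ n, JNP.IsRadon (θ n)) ∧ (∀ n, (JNP.msupport (θ n)).Finite) ∧
      (∀ n, JNP.tvNorm (θ n) = 1) ∧ JNP.WeakStarNull θ ∧
      ∀ n k, n ≠ k → JNP.msupport (θ n) ∩ JNP.msupport (θ k) = ∅ := by
  obtain ⟨μs, hR, hfin, hnorm, hnull⟩ := h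
  choose b hb1 hb0 using fun n => JNP.exists_finsupp (hR n) (hfin n)
  obtain ⟨d, hd1, hd0, hd⟩ := JNP.exists_pairwise_disjoint_support (b := b)
    (fun n => (hb1 n).trans (hnorm n)) (fun f => by simpa only [hb0] using hnull f)
  choose θ hθR hθs hθ1 hθ0 using fun n => JNP.exists_signedMeasure (d n)
  refine ⟨θ, hθR, fun n => (d n).support.finite_toSet.subset (hθs n),
    fun n => (hθ1 n).trans (hd1 n), fun f => by simpa only [hθ0] using hd0 f, fun n k hnk => ?_⟩
  refine ((Finset.disjoint_coe.2 (hd n k hnk)).mono (hθs n) (hθs k)).inter_eq
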